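/- Identify L with a finite set of nonnegative integer exponents, class ℓ having per-item profit (1+ε)^ℓ. Let λ_1, …, λ_T ≥ 0, let W_1 ≤ ⋯ ≤ W_T be capacities, and let N_0 = 0 ≤ N_1 ≤ ⋯ ≤ N_T be utilization vectors (componentwise ordered) with w(N_t) ≤ W_t for every t ∈ [T]. Then the truncations form a feasible nondecreasing sequence, i.e., N_{t−1}^(2) ≤ N_t^(2) and w(N_t^(2)) ≤ W_t for every t ∈ [T], and their profit satisfies Σ_{ℓ∈L} (1+ε)^ℓ · Σ_{t∈[T]} λ_t · (N_t^(2))_ℓ ≥ (1 − 2ε) · Σ_{ℓ∈L} (1+ε)^ℓ · Σ_{t∈[T]} λ_t · (N_t)_ℓ. -/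

import Mathlib

open Finset
open scoped Classical

noncomputable section

namespace IK

variable {ι : Type*} [Fintype ι]

/-- `Wcl wgt ℓ a b = Σ_{j=a}^{b} w_{ℓ,j}`, the total weight of items `a,…,b` of class `ℓ`. -/
def Wcl (wgt : ι → ℕ → ℝ) (ℓ : ι) (a b : ℕ) : ℝ := ∑ j ∈ Finset.Icc a b, wgt ℓ j

/-- The set `H(N)` of classes that are heavy for `N` (here `e = 1/ε`). -/
def heavy (e : ℕ) (N : ι → ℕ) : Finset ι := Finset.univ.filter fun ℓ => e < N ℓ

/-- `W_H(N)`, the weight picked by `N` from heavy classes beyond their first `1/ε` items. -/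
def WH (wgt : ι → ℕ → ℝ) (e : ℕ) (N : ι → ℕ) : ℝ :=
  ∑ ℓ ∈ heavy e N, Wcl wgt ℓ (e + 1) (N ℓ)

/-- `P2[x]`: the least integer power of `2` that is `≥ x` for `x > 0`, and `0` for `x ≤ 0`. -/
def P2 (x : ℝ) : ℝ := if 0 < x then (2 : ℝ) ^ ⌈Real.logb 2 x⌉ else 0

/-- The rounding unit `P2[(ε/|L|)·W_H(N)]`. -/
def base (ε : ℝ) (wgt : ι → ℕ → ℝ) (e : ℕ) (N : ι → ℕ) : ℝ :=
  P2 (ε / (Fintype.card ι) * WH wgt e N)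

/-- The multiplier `μ_ℓ(N)`: the unique integer with
`(μ_ℓ(N)−1)·P2[(ε/|L|)·W_H(N)] < W_ℓ(1/ε+1, N_ℓ) ≤ μ_ℓ(N)·P2[(ε/|L|)·W_H(N)]`. -/
def mu (ε : ℝ) (wgt : ι → ℕ → ℝ) (e : ℕ) (N : ι → ℕ) (ℓ : ι) : ℤ :=
  ⌈Wcl wgt ℓ (e + 1) (N ℓ) / base ε wgt e N⌉

/-- The over-estimate `E_ℓ(N) = μ_ℓ(N)·P2[(ε/|L|)·W_H(N)]`. -/
def Ecl (ε : ℝ) (wgt : ι → ℕ → ℝ) (e : ℕ) (N : ι → ℕ) (ℓ : ι) : ℝ :=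
  (mu ε wgt e N ℓ : ℝ) * base ε wgt e N

/-- The up-rounding `N^(1)` of `N`: coordinates of light classes are kept, while each heavy
class picks `max{k ∈ [1/ε+1, n_ℓ] : W_ℓ(1/ε+1, k) ≤ E_ℓ(N)}` items. -/
def upround (ε : ℝ) (wgt : ι → ℕ → ℝ) (nI : ι → ℕ) (e : ℕ) (N : ι → ℕ) : ι → ℕ :=
  fun ℓ =>
    if e < N ℓ then
      ((Finset.Icc (e + 1) (nI ℓ)).filter fun k => Wcl wgt ℓ (e + 1) k ≤ Ecl ε wgt e N ℓ).sup id
    else N ℓ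

/-- `Δ_ℓ(N) = N^(1)_ℓ − 1/ε`. -/
def delta (ε : ℝ) (wgt : ι → ℕ → ℝ) (nI : ι → ℕ) (e : ℕ) (N : ι → ℕ) (ℓ : ι) : ℕ :=
  upround ε wgt nI e N ℓ - e

/-- The truncation `N^(2)` of `N`: coordinates of light classes are kept, while each heavy
class eliminates its last `⌈2ε·Δ_ℓ(N)⌉` items from `N^(1)`. -/
def trunc (ε : ℝ) (wgt : ι → ℕ → ℝ) (nI : ι → ℕ) (e : ℕ) (N : ι → ℕ) : ι → ℕ :=
  fun ℓ =>
    if e < N ℓ then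
      upround ε wgt nI e N ℓ - (⌈2 * ε * (delta ε wgt nI e N ℓ : ℝ)⌉).toNat
    else upround ε wgt nI e N ℓ

/-- The total weight `w(N) = Σ_ℓ W_ℓ(1, N_ℓ)` of a utilization vector. -/
def wtot (wgt : ι → ℕ → ℝ) (N : ι → ℕ) : ℝ := ∑ ℓ : ι, Wcl wgt ℓ 1 (N ℓ)

end IK

namespace IK

lemma P2_pos {x : ℝ} (hx : 0 < x) : 0 < P2 x := by
  rw [P2, if_pos hx]
  positivity

lemma P2_le_two_mul {x : ℝ} (hx : 0 < x) : P2 x ≤ 2 * x := by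
  rw [P2, if_pos hx, ← Real.rpow_intCast]
  calc (2 : ℝ) ^ ((⌈Real.logb 2 x⌉ : ℤ) : ℝ)
      ≤ 2 ^ (Real.logb 2 x + 1) :=
        Real.rpow_le_rpow_of_exponent_le one_le_two (Int.ceil_lt_add_one _).le
    _ = 2 * x := by
        rw [Real.rpow_add two_pos, Real.rpow_logb two_pos (by norm_num) hx, Real.rpow_one]
        ring

lemma exists_P2_eq_two_pow_mul {x y : ℝ} (hx : 0 < x) (hxy : x ≤ y) :
    ∃ n : ℕ, P2 y = 2 ^ n * P2 x := by
  have hle : ⌈Real.logb 2 x⌉ ≤ ⌈Real.logb 2 y⌉ :=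
    Int.ceil_mono (Real.logb_le_logb_of_le one_lt_two hx hxy)
  obtain ⟨n, hn⟩ := Int.le.dest hle
  refine ⟨n, ?_⟩
  rw [P2, P2, if_pos (hx.trans_le hxy), if_pos hx, ← hn, zpow_add₀ two_ne_zero, zpow_natCast,
    mul_comm]

lemma ceil_div_mul_le_ceil_div_mul {a b x y : ℝ} {n : ℕ} (ha : 0 < a) (hb : b = 2 ^ n * a)
    (hxy : x ≤ y) : (⌈x / a⌉ : ℝ) * a ≤ ⌈y / b⌉ * b := by
  have hb0 : 0 < b := by rw [hb]; positivity
  have hy : y ≤ ⌈y / b⌉ * b := (div_le_iff₀ hb0).1 (Int.le_ceil _)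
  have hceil : ⌈x / a⌉ ≤ ⌈y / b⌉ * 2 ^ n := by
    rw [Int.ceil_le, div_le_iff₀ ha]
    push_cast
    calc x ≤ ⌈y / b⌉ * b := hxy.trans hy
      _ = ⌈y / b⌉ * 2 ^ n * a := by rw [hb]; ring
  calc (⌈x / a⌉ : ℝ) * a ≤ ((⌈y / b⌉ * 2 ^ n : ℤ) : ℝ) * a := by gcongr
    _ = ⌈y / b⌉ * b := by rw [hb]; push_cast; ring

variable {ι : Type*} {wgt : ι → ℕ → ℝ} {nI : ι → ℕ} {ℓ : ι}

lemma Wcl_succ {a b : ℕ} (h : a ≤ b + 1) :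
    Wcl wgt ℓ a (b + 1) = Wcl wgt ℓ a b + wgt ℓ (b + 1) :=
  Finset.sum_Icc_succ_top h _

lemma Wcl_add_Wcl {e k : ℕ} (h : e ≤ k) :
    Wcl wgt ℓ 1 e + Wcl wgt ℓ (e + 1) k = Wcl wgt ℓ 1 k := by
  induction k, h using Nat.le_induction with
  | base => simp [Wcl]
  | succ k hk ih => rw [Wcl_succ (by omega), Wcl_succ (by omega), ← ih, add_assoc]

lemma Wcl_nonneg (hw0 : ∀ ℓ, ∀ j ∈ Finset.Icc 1 (nI ℓ), 0 < wgt ℓ j) {e k : ℕ}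
    (hk : k ≤ nI ℓ) : 0 ≤ Wcl wgt ℓ (e + 1) k := by
  refine Finset.sum_nonneg fun j hj => (hw0 ℓ j ?_).le
  simp only [Finset.mem_Icc] at hj ⊢
  omega

lemma Wcl_pos (hw0 : ∀ ℓ, ∀ j ∈ Finset.Icc 1 (nI ℓ), 0 < wgt ℓ j) {e k : ℕ}
    (hek : e < k) (hk : k ≤ nI ℓ) : 0 < Wcl wgt ℓ (e + 1) k := by
  refine Finset.sum_pos (fun j hj => hw0 ℓ j ?_) ⟨k, by simp; omega⟩
  simp only [Finset.mem_Icc] at hj ⊢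
  omega

lemma Wcl_mono (hw0 : ∀ ℓ, ∀ j ∈ Finset.Icc 1 (nI ℓ), 0 < wgt ℓ j) {e k k' : ℕ}
    (hkk : k ≤ k') (hk : k' ≤ nI ℓ) : Wcl wgt ℓ (e + 1) k ≤ Wcl wgt ℓ (e + 1) k' := by
  refine Finset.sum_le_sum_of_subset_of_nonneg (Finset.Icc_subset_Icc_right hkk)
    fun j hj _ => (hw0 ℓ j ?_).le
  simp only [Finset.mem_Icc] at hj ⊢
  omega

lemma Wcl_le_mul_last (hwm : ∀ ℓ, ∀ j k : ℕ, 1 ≤ j → j ≤ k → k ≤ nI ℓ → wgt ℓ j ≤ wgt ℓ k)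
    {e m k : ℕ} (hmk : e + m ≤ k) (hk : k ≤ nI ℓ) :
    Wcl wgt ℓ (e + 1) (e + m) ≤ m * wgt ℓ k := by
  have h := Finset.sum_le_card_nsmul (Finset.Icc (e + 1) (e + m)) (wgt ℓ) (wgt ℓ k) fun j hj => by
    simp only [Finset.mem_Icc] at hj
    exact hwm ℓ j k (by omega) (by omega) hk
  have hc : e + m + 1 - (e + 1) = m := by omega
  simpa [Wcl, hc] using h

lemma mul_Wcl_le_mul_Wcl
    (hwm : ∀ ℓ, ∀ j k : ℕ, 1 ≤ j → j ≤ k → k ≤ nI ℓ → wgt ℓ j ≤ wgt ℓ k)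
    {e m n : ℕ} (hmn : m ≤ n) (hn : e + n ≤ nI ℓ) :
    n * Wcl wgt ℓ (e + 1) (e + m) ≤ m * Wcl wgt ℓ (e + 1) (e + n) := by
  induction n, hmn using Nat.le_induction with
  | base => exact le_rfl
  | succ n hmn ih =>
    have h1 := ih (by omega)
    have h2 := Wcl_le_mul_last hwm (e := e) (m := m) (k := e + n + 1) (by omega) hn
    rw [← add_assoc, Wcl_succ (by omega)]
    push_cast
    linarith

lemma Wcl_floor_le (hw0 : ∀ ℓ, ∀ j ∈ Finset.Icc 1 (nI ℓ), 0 < wgt ℓ j)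
    (hwm : ∀ ℓ, ∀ j k : ℕ, 1 ≤ j → j ≤ k → k ≤ nI ℓ → wgt ℓ j ≤ wgt ℓ k)
    {e n : ℕ} {c : ℝ} (hc0 : 0 ≤ c) (hc1 : c ≤ 1) (hn0 : 0 < n) (hn : e + n ≤ nI ℓ) :
    Wcl wgt ℓ (e + 1) (e + ⌊c * n⌋₊) ≤ c * Wcl wgt ℓ (e + 1) (e + n) := by
  have hfloor : (⌊c * n⌋₊ : ℝ) ≤ c * n := Nat.floor_le (by positivity)
  have hm : ⌊c * n⌋₊ ≤ n := Nat.floor_le_of_le (mul_le_of_le_one_left (by positivity) hc1)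
  have hn0' : (0 : ℝ) < n := by exact_mod_cast hn0
  refine le_of_mul_le_mul_left ?_ hn0'
  calc n * Wcl wgt ℓ (e + 1) (e + ⌊c * n⌋₊)
      ≤ ⌊c * n⌋₊ * Wcl wgt ℓ (e + 1) (e + n) := mul_Wcl_le_mul_Wcl hwm hm hn
    _ ≤ c * n * Wcl wgt ℓ (e + 1) (e + n) :=
        mul_le_mul_of_nonneg_right hfloor (Wcl_nonneg hw0 hn)
    _ = n * (c * Wcl wgt ℓ (e + 1) (e + n)) := by ring

variable [Fintype ι] {ε : ℝ} {e : ℕ} {N N' : ι → ℕ}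

lemma WH_pos (hw0 : ∀ ℓ, ∀ j ∈ Finset.Icc 1 (nI ℓ), 0 < wgt ℓ j)
    (hN : ∀ ℓ, N ℓ ≤ nI ℓ) (hℓ : e < N ℓ) : 0 < WH wgt e N := by
  refine Finset.sum_pos (fun i hi => Wcl_pos hw0 ?_ (hN i)) ⟨ℓ, by simpa [heavy] using hℓ⟩
  simpa [heavy] using hi

lemma WH_mono (hw0 : ∀ ℓ, ∀ j ∈ Finset.Icc 1 (nI ℓ), 0 < wgt ℓ j)
    (hN' : ∀ ℓ, N' ℓ ≤ nI ℓ) (hNN : ∀ ℓ, N ℓ ≤ N' ℓ) : WH wgt e N ≤ WH wgt e N' := by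
  have hsub : heavy e N ⊆ heavy e N' := fun i hi => by
    simp only [heavy, Finset.mem_filter, Finset.mem_univ, true_and] at hi ⊢
    exact hi.trans_le (hNN i)
  calc WH wgt e N ≤ ∑ i ∈ heavy e N, Wcl wgt i (e + 1) (N' i) :=
        Finset.sum_le_sum fun i _ => Wcl_mono hw0 (hNN i) (hN' i)
    _ ≤ WH wgt e N' :=
        Finset.sum_le_sum_of_subset_of_nonneg hsub fun i _ _ => Wcl_nonneg hw0 (hN' i)

lemma scaled_WH_pos (hε0 : 0 < ε) (hw0 : ∀ ℓ, ∀ j ∈ Finset.Icc 1 (nI ℓ), 0 < wgt ℓ j)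
    (hN : ∀ ℓ, N ℓ ≤ nI ℓ) (hℓ : e < N ℓ) : 0 < ε / Fintype.card ι * WH wgt e N := by
  have hcard : (0 : ℝ) < Fintype.card ι := by exact_mod_cast Fintype.card_pos_iff.2 ⟨ℓ⟩
  have := WH_pos hw0 hN hℓ
  positivity

lemma Wcl_le_Ecl (hε0 : 0 < ε) (hw0 : ∀ ℓ, ∀ j ∈ Finset.Icc 1 (nI ℓ), 0 < wgt ℓ j)
    (hN : ∀ ℓ, N ℓ ≤ nI ℓ) (hℓ : e < N ℓ) :
    Wcl wgt ℓ (e + 1) (N ℓ) ≤ Ecl ε wgt e N ℓ :=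
  (div_le_iff₀ (P2_pos (scaled_WH_pos hε0 hw0 hN hℓ))).1 (Int.le_ceil _)

lemma Ecl_le_Wcl_add (hε0 : 0 < ε) (hw0 : ∀ ℓ, ∀ j ∈ Finset.Icc 1 (nI ℓ), 0 < wgt ℓ j)
    (hN : ∀ ℓ, N ℓ ≤ nI ℓ) (hℓ : e < N ℓ) :
    Ecl ε wgt e N ℓ ≤ Wcl wgt ℓ (e + 1) (N ℓ) + 2 * (ε / Fintype.card ι * WH wgt e N) := by
  have hx := scaled_WH_pos hε0 hw0 hN hℓ
  have hb : 0 < base ε wgt e N := P2_pos hx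
  have hb2 : base ε wgt e N ≤ _ := P2_le_two_mul hx
  have hmu : (mu ε wgt e N ℓ : ℝ) ≤ Wcl wgt ℓ (e + 1) (N ℓ) / base ε wgt e N + 1 :=
    (Int.ceil_lt_add_one _).le
  calc Ecl ε wgt e N ℓ
      ≤ (Wcl wgt ℓ (e + 1) (N ℓ) / base ε wgt e N + 1) * base ε wgt e N :=
        mul_le_mul_of_nonneg_right hmu hb.le
    _ = Wcl wgt ℓ (e + 1) (N ℓ) + base ε wgt e N := by field_simp
    _ ≤ _ := by gcongr

lemma Ecl_mono (hε0 : 0 < ε) (hw0 : ∀ ℓ, ∀ j ∈ Finset.Icc 1 (nI ℓ), 0 < wgt ℓ j)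
    (hN' : ∀ ℓ, N' ℓ ≤ nI ℓ) (hNN : ∀ ℓ, N ℓ ≤ N' ℓ) (hℓ : e < N ℓ) :
    Ecl ε wgt e N ℓ ≤ Ecl ε wgt e N' ℓ := by
  have hx := scaled_WH_pos hε0 hw0 (fun i => (hNN i).trans (hN' i)) hℓ
  obtain ⟨n, hn⟩ := exists_P2_eq_two_pow_mul hx
    (mul_le_mul_of_nonneg_left (WH_mono hw0 hN' hNN) (by positivity))
  exact ceil_div_mul_le_ceil_div_mul (P2_pos hx) hn (Wcl_mono hw0 (hNN ℓ) (hN' ℓ))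

lemma le_upround (hε0 : 0 < ε) (hw0 : ∀ ℓ, ∀ j ∈ Finset.Icc 1 (nI ℓ), 0 < wgt ℓ j)
    (hN : ∀ ℓ, N ℓ ≤ nI ℓ) : N ℓ ≤ upround ε wgt nI e N ℓ := by
  by_cases hℓ : e < N ℓ
  · rw [upround, if_pos hℓ]
    refine Finset.le_sup (f := id) (Finset.mem_filter.2 ⟨?_, Wcl_le_Ecl hε0 hw0 hN hℓ⟩)
    exact Finset.mem_Icc.2 ⟨hℓ, hN ℓ⟩
  · rw [upround, if_neg hℓ]

lemma upround_mem (hε0 : 0 < ε) (hw0 : ∀ ℓ, ∀ j ∈ Finset.Icc 1 (nI ℓ), 0 < wgt ℓ j)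
    (hN : ∀ ℓ, N ℓ ≤ nI ℓ) (hℓ : e < N ℓ) :
    upround ε wgt nI e N ℓ ∈
      (Finset.Icc (e + 1) (nI ℓ)).filter fun k => Wcl wgt ℓ (e + 1) k ≤ Ecl ε wgt e N ℓ := by
  obtain ⟨k, hk, hk'⟩ := Finset.exists_mem_eq_sup
    ((Finset.Icc (e + 1) (nI ℓ)).filter fun k => Wcl wgt ℓ (e + 1) k ≤ Ecl ε wgt e N ℓ)
    ⟨N ℓ, Finset.mem_filter.2 ⟨Finset.mem_Icc.2 ⟨hℓ, hN ℓ⟩, Wcl_le_Ecl hε0 hw0 hN hℓ⟩⟩ id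
  rw [upround, if_pos hℓ, hk']
  exact hk

lemma upround_mono (hε0 : 0 < ε) (hw0 : ∀ ℓ, ∀ j ∈ Finset.Icc 1 (nI ℓ), 0 < wgt ℓ j)
    (hN' : ∀ ℓ, N' ℓ ≤ nI ℓ) (hNN : ∀ ℓ, N ℓ ≤ N' ℓ) (hℓ : e < N ℓ) :
    upround ε wgt nI e N ℓ ≤ upround ε wgt nI e N' ℓ := by
  rw [upround, upround, if_pos hℓ, if_pos (hℓ.trans_le (hNN ℓ))]
  exact Finset.sup_mono <| Finset.monotone_filter_right _ fun k _ hk =>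
    le_trans hk (Ecl_mono hε0 hw0 hN' hNN hℓ)

lemma trunc_of_light (hℓ : ¬ e < N ℓ) : trunc ε wgt nI e N ℓ = N ℓ := by
  rw [trunc, if_neg hℓ, upround, if_neg hℓ]

lemma sub_toNat_ceil {x : ℝ} (hx0 : 0 ≤ x) (n : ℕ) (hx : x * n ≤ n) :
    n - ⌈x * n⌉.toNat = ⌊(1 - x) * n⌋₊ := by
  have h : ⌊(1 - x) * n⌋ = n - ⌈x * n⌉ := by
    rw [show (1 - x) * (n : ℝ) = (n : ℤ) + -(x * n) by push_cast; ring, Int.floor_intCast_add,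
      Int.floor_neg, sub_eq_add_neg]
  have h0 : 0 ≤ ⌈x * n⌉ := Int.ceil_nonneg (by positivity)
  have h1 : ⌈x * n⌉ ≤ n := Int.ceil_le.2 (by exact_mod_cast hx)
  rw [← Int.floor_toNat, h]
  omega

lemma trunc_of_heavy (hε0 : 0 < ε) (hε : 2 * ε ≤ 1)
    (hw0 : ∀ ℓ, ∀ j ∈ Finset.Icc 1 (nI ℓ), 0 < wgt ℓ j)
    (hN : ∀ ℓ, N ℓ ≤ nI ℓ) (hℓ : e < N ℓ) :
    trunc ε wgt nI e N ℓ = e + ⌊(1 - 2 * ε) * (delta ε wgt nI e N ℓ : ℝ)⌋₊ := by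
  have hle : 2 * ε * (delta ε wgt nI e N ℓ : ℝ) ≤ delta ε wgt nI e N ℓ :=
    mul_le_of_le_one_left (by positivity) hε
  have hceil : ⌈2 * ε * (delta ε wgt nI e N ℓ : ℝ)⌉ ≤ delta ε wgt nI e N ℓ :=
    Int.ceil_le.2 (by exact_mod_cast hle)
  have hup : upround ε wgt nI e N ℓ = e + delta ε wgt nI e N ℓ := by
    have := le_upround (ε := ε) (e := e) (ℓ := ℓ) hε0 hw0 hN
    rw [delta]
    omega
  rw [← sub_toNat_ceil (by positivity) _ hle, trunc, if_pos hℓ, hup]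
  omega

lemma trunc_mono (hε0 : 0 < ε) (hε : 2 * ε ≤ 1)
    (hw0 : ∀ ℓ, ∀ j ∈ Finset.Icc 1 (nI ℓ), 0 < wgt ℓ j)
    (hN' : ∀ ℓ, N' ℓ ≤ nI ℓ) (hNN : ∀ ℓ, N ℓ ≤ N' ℓ) (ℓ : ι) :
    trunc ε wgt nI e N ℓ ≤ trunc ε wgt nI e N' ℓ := by
  by_cases hℓ' : e < N' ℓ
  · rw [trunc_of_heavy hε0 hε hw0 hN' hℓ']
    by_cases hℓ : e < N ℓ
    · rw [trunc_of_heavy hε0 hε hw0 (fun i => (hNN i).trans (hN' i)) hℓ]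
      have hδ : delta ε wgt nI e N ℓ ≤ delta ε wgt nI e N' ℓ :=
        Nat.sub_le_sub_right (upround_mono hε0 hw0 hN' hNN hℓ) e
      have hc : 0 ≤ 1 - 2 * ε := by linarith
      gcongr
    · rw [trunc_of_light hℓ]
      omega
  · rw [trunc_of_light hℓ', trunc_of_light (fun h => hℓ' (h.trans_le (hNN ℓ)))]
    exact hNN ℓ

lemma Wcl_trunc_le (hε0 : 0 < ε) (hε : 2 * ε ≤ 1)
    (hw0 : ∀ ℓ, ∀ j ∈ Finset.Icc 1 (nI ℓ), 0 < wgt ℓ j)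
    (hwm : ∀ ℓ, ∀ j k : ℕ, 1 ≤ j → j ≤ k → k ≤ nI ℓ → wgt ℓ j ≤ wgt ℓ k)
    (hN : ∀ ℓ, N ℓ ≤ nI ℓ) (hℓ : e < N ℓ) :
    Wcl wgt ℓ (e + 1) (trunc ε wgt nI e N ℓ) ≤ (1 - 2 * ε) * Ecl ε wgt e N ℓ := by
  have hmem := upround_mem hε0 hw0 hN hℓ
  rw [Finset.mem_filter, Finset.mem_Icc] at hmem
  have hup : e + delta ε wgt nI e N ℓ = upround ε wgt nI e N ℓ := by
    rw [delta]
    omega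
  have hfloor := Wcl_floor_le hw0 hwm (e := e) (n := delta ε wgt nI e N ℓ) (ℓ := ℓ)
    (c := 1 - 2 * ε) (by linarith) (by linarith) (by omega) (by omega)
  rw [trunc_of_heavy hε0 hε hw0 hN hℓ]
  refine hfloor.trans (mul_le_mul_of_nonneg_left ?_ (by linarith))
  rw [hup]
  exact hmem.2

lemma wtot_trunc_le (hε0 : 0 < ε) (hε : 2 * ε ≤ 1)
    (hw0 : ∀ ℓ, ∀ j ∈ Finset.Icc 1 (nI ℓ), 0 < wgt ℓ j)
    (hwm : ∀ ℓ, ∀ j k : ℕ, 1 ≤ j → j ≤ k → k ≤ nI ℓ → wgt ℓ j ≤ wgt ℓ k)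
    (hN : ∀ ℓ, N ℓ ≤ nI ℓ) :
    wtot wgt (trunc ε wgt nI e N) ≤ wtot wgt N := by
  have hWH : 0 ≤ WH wgt e N := Finset.sum_nonneg fun i _ => Wcl_nonneg hw0 (hN i)
  have hexcess : ∑ i ∈ heavy e N, 2 * (ε / Fintype.card ι * WH wgt e N)
      ≤ 2 * ε * WH wgt e N := by
    rw [Finset.sum_const, nsmul_eq_mul]
    have hcard : ((heavy e N).card : ℝ) ≤ Fintype.card ι := by
      exact_mod_cast Finset.card_le_univ _
    calc ((heavy e N).card : ℝ) * (2 * (ε / Fintype.card ι * WH wgt e N))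
        = (heavy e N).card / Fintype.card ι * (2 * ε * WH wgt e N) := by ring
      _ ≤ 1 * (2 * ε * WH wgt e N) :=
          mul_le_mul_of_nonneg_right (div_le_one_of_le₀ hcard (by positivity)) (by positivity)
      _ = 2 * ε * WH wgt e N := one_mul _
  have hheavy : ∑ i ∈ heavy e N, Wcl wgt i (e + 1) (trunc ε wgt nI e N i) ≤ WH wgt e N := by
    calc ∑ i ∈ heavy e N, Wcl wgt i (e + 1) (trunc ε wgt nI e N i)
        ≤ ∑ i ∈ heavy e N, (1 - 2 * ε) *
            (Wcl wgt i (e + 1) (N i) + 2 * (ε / Fintype.card ι * WH wgt e N)) := by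
          refine Finset.sum_le_sum fun i hi => ?_
          have hi : e < N i := by simpa [heavy] using hi
          exact (Wcl_trunc_le hε0 hε hw0 hwm hN hi).trans
            (mul_le_mul_of_nonneg_left (Ecl_le_Wcl_add hε0 hw0 hN hi) (by linarith))
      _ ≤ (1 - 2 * ε) * (WH wgt e N + 2 * ε * WH wgt e N) := by
          rw [← Finset.mul_sum, Finset.sum_add_distrib]
          exact mul_le_mul_of_nonneg_left (add_le_add_right hexcess _) (by linarith)
      _ ≤ WH wgt e N := by nlinarith [mul_nonneg (sq_nonneg ε) hWH]
  have hdiff : ∀ i, Wcl wgt i 1 (trunc ε wgt nI e N i) - Wcl wgt i 1 (N i) =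
      if e < N i then
        Wcl wgt i (e + 1) (trunc ε wgt nI e N i) - Wcl wgt i (e + 1) (N i) else 0 := fun i => by
    split_ifs with hi
    · have hle : e ≤ trunc ε wgt nI e N i := by
        rw [trunc_of_heavy hε0 hε hw0 hN hi]
        omega
      rw [← Wcl_add_Wcl hi.le, ← Wcl_add_Wcl hle]
      ring
    · rw [trunc_of_light hi, sub_self]
  rw [← sub_nonpos, wtot, wtot, ← Finset.sum_sub_distrib, Finset.sum_congr rfl fun i _ => hdiff i,
    ← Finset.sum_filter, Finset.sum_sub_distrib]
  exact sub_nonpos.2 hheavy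

lemma one_sub_mul_le_trunc (hε0 : 0 < ε) (hε : 2 * ε ≤ 1) (he : (e : ℝ) * ε = 1)
    (hw0 : ∀ ℓ, ∀ j ∈ Finset.Icc 1 (nI ℓ), 0 < wgt ℓ j)
    (hN : ∀ ℓ, N ℓ ≤ nI ℓ) (ℓ : ι) :
    (1 - 2 * ε) * (N ℓ : ℝ) ≤ trunc ε wgt nI e N ℓ := by
  by_cases hℓ : e < N ℓ
  · have hδ : (N ℓ : ℝ) ≤ e + delta ε wgt nI e N ℓ := by
      have hup := le_upround (ε := ε) (e := e) (ℓ := ℓ) hε0 hw0 hN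
      rw [delta]
      norm_cast
      omega
    have hfloor := Nat.lt_floor_add_one ((1 - 2 * ε) * (delta ε wgt nI e N ℓ : ℝ))
    have hmul := mul_le_mul_of_nonneg_left hδ (show 0 ≤ 1 - 2 * ε by linarith)
    rw [trunc_of_heavy hε0 hε hw0 hN hℓ]
    push_cast
    linarith
  · rw [trunc_of_light hℓ]
    exact mul_le_of_le_one_left (by positivity) (by linarith)

end IK

/-- Identify `L` with a finite set of nonnegative integer exponents (class
`ℓ` has per-item profit `(1+ε)^ℓ`).  Given coefficients `λ_1,…,λ_T ≥ 0`, nondecreasing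
capacities `W_1 ≤ ⋯ ≤ W_T`, and a chain of utilization vectors `N_0 = 0 ≤ N_1 ≤ ⋯ ≤ N_T`
with `w(N_t) ≤ W_t` for all `t ∈ [T]`, the truncations form a feasible nondecreasing
sequence — `N_{t−1}^(2) ≤ N_t^(2)` and `w(N_t^(2)) ≤ W_t` for every `t ∈ [T]` — and their
profit satisfies
`Σ_ℓ (1+ε)^ℓ · Σ_t λ_t·(N_t^(2))_ℓ ≥ (1 − 2ε) · Σ_ℓ (1+ε)^ℓ · Σ_t λ_t·(N_t)_ℓ`. -/
theorem stmt10
    (Lset : Finset ℕ) (hLne : Lset.Nonempty)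
    (ε : ℝ) (e : ℕ) (hε0 : 0 < ε) (hε : ε < 1 / 4) (he : (e : ℝ) * ε = 1)
    (nI : ↥Lset → ℕ) (wgt : ↥Lset → ℕ → ℝ)
    (hw0 : ∀ ℓ, ∀ j ∈ Finset.Icc 1 (nI ℓ), 0 < wgt ℓ j)
    (hwm : ∀ ℓ, ∀ j k : ℕ, 1 ≤ j → j ≤ k → k ≤ nI ℓ → wgt ℓ j ≤ wgt ℓ k)
    (T : ℕ) (lam Wcap : ℕ → ℝ)
    (hlam : ∀ t ∈ Finset.Icc 1 T, 0 ≤ lam t)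
    (hWmono : ∀ s t : ℕ, 1 ≤ s → s ≤ t → t ≤ T → Wcap s ≤ Wcap t)
    (N : ℕ → ↥Lset → ℕ)
    (hN0 : ∀ ℓ, N 0 ℓ = 0)
    (hNmono : ∀ t ∈ Finset.Icc 1 T, ∀ ℓ, N (t - 1) ℓ ≤ N t ℓ)
    (hNutil : ∀ t : ℕ, t ≤ T → ∀ ℓ, N t ℓ ≤ nI ℓ)
    (hNcap : ∀ t ∈ Finset.Icc 1 T, IK.wtot wgt (N t) ≤ Wcap t) :
    (∀ t ∈ Finset.Icc 1 T,
        (∀ ℓ, IK.trunc ε wgt nI e (N (t - 1)) ℓ ≤ IK.trunc ε wgt nI e (N t) ℓ) ∧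
          IK.wtot wgt (IK.trunc ε wgt nI e (N t)) ≤ Wcap t) ∧
      (1 - 2 * ε) *
          ∑ ℓ : ↥Lset, (1 + ε) ^ (ℓ : ℕ) * ∑ t ∈ Finset.Icc 1 T, lam t * ((N t ℓ : ℕ) : ℝ)
        ≤ ∑ ℓ : ↥Lset, (1 + ε) ^ (ℓ : ℕ) *
            ∑ t ∈ Finset.Icc 1 T, lam t * ((IK.trunc ε wgt nI e (N t) ℓ : ℕ) : ℝ) := by
  have hε2 : 2 * ε ≤ 1 := by linarith
  refine ⟨fun t ht => ?_, ?_⟩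
  · have hN := hNutil t (Finset.mem_Icc.1 ht).2
    exact ⟨IK.trunc_mono hε0 hε2 hw0 hN (hNmono t ht),
      (IK.wtot_trunc_le hε0 hε2 hw0 hwm hN).trans (hNcap t ht)⟩
  · rw [Finset.mul_sum]
    refine Finset.sum_le_sum fun ℓ _ => ?_
    rw [mul_left_comm, Finset.mul_sum]
    refine mul_le_mul_of_nonneg_left (Finset.sum_le_sum fun t ht => ?_) (by positivity)
    rw [mul_left_comm]
    exact mul_le_mul_of_nonneg_left
      (IK.one_sub_mul_le_trunc hε0 hε2 he hw0 (hNutil t (Finset.mem_Icc.1 ht).2) ℓ) (hlam t ht)
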